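/- Let B_1, ..., B_M ∈ ℝ^{N×N}, let N₀ := ∑_{m=1}^M B_m B_mᵀ with eigenvalues λ_1(N₀) ≥ ... ≥ λ_N(N₀) in nonincreasing order with multiplicity, and let k ≤ N. Then the minimum of ∑_{m=1}^M ‖B_m − U V_mᵀ‖_F² over all U ∈ ℝ^{N×k} with UᵀU = I_k and all V_1, ..., V_M ∈ ℝ^{N×k} is attained and equals ∑_{m=1}^M ‖B_m‖_F² − ∑_{i=1}^k λ_i(N₀). -/

import Mathlib

open Matrix BigOperators

/-- Squared Frobenius norm of a real matrix: `‖A‖_F² = tr (A * Aᵀ)`. -/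
noncomputable def frobSq {n m : ℕ} (A : Matrix (Fin n) (Fin m) ℝ) : ℝ :=
  Matrix.trace (A * Aᵀ)

theorem frobSq_nonneg {n m : ℕ} (A : Matrix (Fin n) (Fin m) ℝ) : 0 ≤ frobSq A := by
  simp only [frobSq, Matrix.trace, Matrix.diag_apply, Matrix.mul_apply, Matrix.transpose_apply]
  exact Finset.sum_nonneg fun i _ => Finset.sum_nonneg fun j _ => mul_self_nonneg _

/-- Completing the square: the residual splits into a part independent of `V` and the squared
distance of `V` from the optimal `Bᵀ * U`. -/
theorem frobSq_sub_mul_transpose {n m k : ℕ} (B : Matrix (Fin n) (Fin m) ℝ)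
    (U : Matrix (Fin n) (Fin k) ℝ) (V : Matrix (Fin m) (Fin k) ℝ) (hU : Uᵀ * U = 1) :
    frobSq (B - U * Vᵀ) = frobSq B - trace (Uᵀ * (B * Bᵀ) * U) + frobSq (V - Bᵀ * U) := by
  have h₁ : trace (U * Vᵀ * Bᵀ) = trace (V * (Uᵀ * B)) := by
    rw [← trace_transpose]
    simp only [transpose_mul, transpose_transpose]
    rw [trace_mul_comm, Matrix.mul_assoc]
  have h₂ : trace (B * (V * Uᵀ)) = trace (V * (Uᵀ * B)) := by
    rw [trace_mul_comm, Matrix.mul_assoc]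
  have h₃ : trace (U * Vᵀ * (V * Uᵀ)) = trace (V * Vᵀ) := by
    rw [trace_mul_comm, Matrix.mul_assoc, ← Matrix.mul_assoc Uᵀ, hU, Matrix.one_mul]
  have h₄ : trace (Bᵀ * U * Vᵀ) = trace (V * (Uᵀ * B)) := by
    rw [← trace_transpose]
    simp only [transpose_mul, transpose_transpose]
  have h₅ : trace (Uᵀ * (B * Bᵀ) * U) = trace (Bᵀ * U * (Uᵀ * B)) := by
    rw [trace_mul_comm (Bᵀ * U)]
    simp only [Matrix.mul_assoc]
  simp only [frobSq, transpose_sub, transpose_mul, transpose_transpose, Matrix.sub_mul,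
    Matrix.mul_sub, trace_sub, h₁, h₂, h₃, h₄, h₅]
  ring

theorem sum_frobSq_sub_mul_transpose {M n m k : ℕ} (B : Fin M → Matrix (Fin n) (Fin m) ℝ)
    (U : Matrix (Fin n) (Fin k) ℝ) (V : Fin M → Matrix (Fin m) (Fin k) ℝ) (hU : Uᵀ * U = 1) :
    ∑ i, frobSq (B i - U * (V i)ᵀ) =
      ∑ i, frobSq (B i) - trace (Uᵀ * (∑ i, B i * (B i)ᵀ) * U)
        + ∑ i, frobSq (V i - (B i)ᵀ * U) := by
  simp only [frobSq_sub_mul_transpose _ _ _ hU, Finset.sum_add_distrib, Finset.sum_sub_distrib,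
    Matrix.mul_sum, Matrix.sum_mul, trace_sum]

/-- A weighted sum of a nonincreasing sequence, with weights in `[0, 1]` of total mass `k`,
is at most the sum of the first `k` terms. -/
theorem sum_mul_le_sum_filter_lt {N k : ℕ} (hk : k ≤ N) {lam w : Fin N → ℝ} (hlam : Antitone lam)
    (hw₀ : ∀ i, 0 ≤ w i) (hw₁ : ∀ i, w i ≤ 1) (hw : ∑ i, w i = k) :
    ∑ i, lam i * w i ≤ ∑ i ∈ Finset.univ.filter (fun i : Fin N => (i : ℕ) < k), lam i := by
  obtain ⟨c, hc₁, hc₂⟩ : ∃ c, (∀ i : Fin N, (i : ℕ) < k → c ≤ lam i) ∧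
      ∀ i : Fin N, k ≤ (i : ℕ) → lam i ≤ c := by
    rcases Nat.eq_zero_or_pos N with rfl | hN
    · exact ⟨0, fun i => i.elim0, fun i => i.elim0⟩
    rcases Nat.eq_zero_or_pos k with rfl | hk'
    · exact ⟨lam ⟨0, hN⟩, fun i hi => absurd hi (Nat.not_lt_zero _),
        fun i _ => hlam (Fin.mk_le_of_le_val (Nat.zero_le _))⟩
    · refine ⟨lam ⟨k - 1, by omega⟩, fun i hi => hlam ?_, fun i hi => hlam ?_⟩ <;>
        rw [Fin.le_def] <;> dsimp only <;> omega
  have hcard : ∑ i : Fin N, (if (i : ℕ) < k then (1 : ℝ) else 0) = k := by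
    rw [Finset.sum_boole, Fin.card_filter_val_lt, min_eq_right hk]
  have hle : ∑ i, (lam i - c) * w i ≤ ∑ i, (lam i - c) * (if (i : ℕ) < k then (1 : ℝ) else 0) := by
    refine Finset.sum_le_sum fun i _ => ?_
    split_ifs with hi
    · exact mul_le_mul_of_nonneg_left (hw₁ i) (sub_nonneg.2 (hc₁ i hi))
    · rw [mul_zero]
      exact mul_nonpos_of_nonpos_of_nonneg (sub_nonpos.2 (hc₂ i (not_lt.1 hi))) (hw₀ i)
  simp only [sub_mul, Finset.sum_sub_distrib, ← Finset.mul_sum, hw, hcard] at hle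
  simpa [Finset.sum_filter] using hle

theorem mul_transpose_apply_self_le_one {N k : ℕ} {W : Matrix (Fin N) (Fin k) ℝ}
    (hW : Wᵀ * W = 1) (i : Fin N) : (W * Wᵀ) i i ≤ 1 := by
  have hP : W * Wᵀ * (W * Wᵀ)ᵀ = W * Wᵀ := by
    rw [transpose_mul, transpose_transpose, Matrix.mul_assoc, ← Matrix.mul_assoc Wᵀ, hW,
      Matrix.one_mul]
  generalize W * Wᵀ = P at hP ⊢
  have hsum : ∑ j, P i j * P i j = P i i := by
    conv_rhs => rw [← hP]
    simp only [mul_apply, transpose_apply]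
  have := Finset.single_le_sum (f := fun j => P i j * P i j) (fun j _ => mul_self_nonneg _)
    (Finset.mem_univ i)
  nlinarith

/-- Ky Fan's inequality for a diagonal matrix. -/
theorem trace_transpose_mul_diagonal_mul_le {N k : ℕ} (hk : k ≤ N) {lam : Fin N → ℝ}
    (hlam : Antitone lam) {W : Matrix (Fin N) (Fin k) ℝ} (hW : Wᵀ * W = 1) :
    trace (Wᵀ * diagonal lam * W) ≤
      ∑ i ∈ Finset.univ.filter (fun i : Fin N => (i : ℕ) < k), lam i := by
  have htrace : trace (Wᵀ * diagonal lam * W) = ∑ i, lam i * (W * Wᵀ) i i := by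
    rw [Matrix.mul_assoc, trace_mul_comm, Matrix.mul_assoc]
    simp only [trace, diag_apply, diagonal_mul]
  rw [htrace]
  refine sum_mul_le_sum_filter_lt hk hlam (fun i => ?_) (mul_transpose_apply_self_le_one hW) ?_
  · rw [mul_apply]
    exact Finset.sum_nonneg fun j _ => mul_self_nonneg (W i j)
  · change trace (W * Wᵀ) = k
    rw [trace_mul_comm, hW, trace_one, Fintype.card_fin]

theorem sum_castLE_eq_sum_filter_lt {N k : ℕ} (hk : k ≤ N) (f : Fin N → ℝ) :
    ∑ j, f (Fin.castLE hk j) = ∑ i ∈ Finset.univ.filter (fun i : Fin N => (i : ℕ) < k), f i := by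
  refine Finset.sum_bij (fun j _ => Fin.castLE hk j) (fun j _ => by simp)
    (fun _ _ _ _ h => Fin.castLE_injective hk h) (fun i hi => ?_) (fun _ _ => rfl)
  exact ⟨⟨i, (Finset.mem_filter.1 hi).2⟩, Finset.mem_univ _, rfl⟩

/-- The minimum value of the GLRAM objective: with `N₀ = ∑ₘ Bₘ Bₘᵀ` having
eigenvalues `λ₁ ≥ … ≥ λ_N` (with multiplicity, encoded by an orthogonal
diagonalization with `λ` nonincreasing) and `k ≤ N`, the minimum of
`∑ₘ ‖Bₘ − U Vₘᵀ‖_F²` over all `U` with `Uᵀ U = I_k` and all `V₁, …, V_M`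
is attained and equals `∑ₘ ‖Bₘ‖_F² − ∑_{i=1}^k λᵢ`. -/
theorem stmt9 {M N k : ℕ} (hk : k ≤ N)
    (B : Fin M → Matrix (Fin N) (Fin N) ℝ)
    (lam : Fin N → ℝ) (hlam : Antitone lam)
    (Q : Matrix (Fin N) (Fin N) ℝ) (hQ : Qᵀ * Q = 1)
    (hdecomp : (∑ m : Fin M, B m * (B m)ᵀ) = Q * Matrix.diagonal lam * Qᵀ) :
    IsLeast
      {t : ℝ | ∃ (U : Matrix (Fin N) (Fin k) ℝ) (V : Fin M → Matrix (Fin N) (Fin k) ℝ),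
        Uᵀ * U = 1 ∧ t = ∑ m : Fin M, frobSq (B m - U * (V m)ᵀ)}
      (∑ m : Fin M, frobSq (B m)
        - ∑ i ∈ Finset.univ.filter (fun i : Fin N => (i : ℕ) < k), lam i) := by
  constructor
  · set e := Fin.castLE hk
    set U := Q.submatrix id e
    have hU : Uᵀ * U = 1 := by
      change (Qᵀ * Q).submatrix e e = 1
      rw [hQ, submatrix_one _ (Fin.castLE_injective hk)]
    have hdiag : Qᵀ * (Q * diagonal lam * Qᵀ) * Q = diagonal lam := by
      rw [Matrix.mul_assoc, Matrix.mul_assoc, hQ, Matrix.mul_one, ← Matrix.mul_assoc, hQ,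
        Matrix.one_mul]
    have hsub (A : Matrix (Fin N) (Fin N) ℝ) : Uᵀ * A * U = (Qᵀ * A * Q).submatrix e e := rfl
    refine ⟨U, fun m => (B m)ᵀ * U, hU, ?_⟩
    rw [sum_frobSq_sub_mul_transpose B U _ hU, hdecomp, hsub, hdiag,
      ← sum_castLE_eq_sum_filter_lt hk]
    simp [frobSq, trace, e]
  · rintro t ⟨U, V, hU, rfl⟩
    have hQ' : Q * Qᵀ = 1 := mul_eq_one_comm.1 hQ
    have hW : (Qᵀ * U)ᵀ * (Qᵀ * U) = 1 := by
      rw [transpose_mul, transpose_transpose, Matrix.mul_assoc, ← Matrix.mul_assoc Q, hQ',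
        Matrix.one_mul, hU]
    have hle := trace_transpose_mul_diagonal_mul_le hk hlam hW
    have hconj : (Qᵀ * U)ᵀ * diagonal lam * (Qᵀ * U) = Uᵀ * (Q * diagonal lam * Qᵀ) * U := by
      simp only [transpose_mul, transpose_transpose, Matrix.mul_assoc]
    rw [hconj] at hle
    rw [sum_frobSq_sub_mul_transpose B U V hU, hdecomp]
    have := Finset.sum_nonneg fun m (_ : m ∈ Finset.univ) => frobSq_nonneg (V m - (B m)ᵀ * U)
    linarith
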